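/- arXiv:1704.00707 — 2 statements merged into one kernel-verified Lean document; each statement's English description precedes it below -/
import Mathlib

section
/- Let G be a finite group, x, y ∈ G, and let I be a subset of the irreducible characters of G closed under complex conjugation such that χ(x) ≠ χ(y) for all χ ∈ I, and χ(x) = χ(y) for all irreducible χ not in I. If ψ is a character of G with ψ(x) = ψ(y) ≠ 0, then for any χ ∈ I, the product character ψ·χ has some constituent lying in I. -/
open CategoryTheory

noncomputable section

/-- `ψ` is a (complex) character of the finite group `G`:
the character of some finite-dimensional complex representation. -/
def IsChar (G : Type) [Group G] (ψ : G → ℂ) : Prop :=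
  ∃ V : FDRep ℂ G, ∀ g, ψ g = V.character g

/-- `χ` is an irreducible (complex) character of `G`. -/
def IsIrrChar (G : Type) [Group G] (χ : G → ℂ) : Prop :=
  ∃ V : FDRep ℂ G, Simple V ∧ ∀ g, χ g = V.character g

/-- The standard inner product of class functions on a finite group. -/
def charInner (G : Type) [Group G] [Fintype G] (φ θ : G → ℂ) : ℂ :=
  (Fintype.card G : ℂ)⁻¹ * ∑ g : G, φ g * (starRingEnd ℂ) (θ g)

open Module in
/-- If `f` is a semisimple complex endomorphism and `g` acts on each eigenspace of `f` as a scalar,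
then the trace of `g` is the sum of these scalars, weighted by the dimensions of the eigenspaces. -/
theorem trace_eq_sum_of_eigenspaces {V : Type*} [AddCommGroup V] [Module ℂ V]
    [FiniteDimensional ℂ V] {f : End ℂ V} (hf : f.IsSemisimple) (g : End ℂ V) (c : ℂ → ℂ)
    (hg : ∀ μ, ∀ v ∈ f.eigenspace μ, g v = c μ • v)
    (hfin : {μ | f.eigenspace μ ≠ ⊥}.Finite) :
    LinearMap.trace ℂ V g = ∑ μ ∈ hfin.toFinset, c μ * finrank ℂ (f.eigenspace μ) := by
  have hint : DirectSum.IsInternal f.eigenspace :=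
    DirectSum.isInternal_submodule_of_iSupIndep_of_iSup_eq_top f.eigenspaces_iSupIndep
      hf.iSup_eigenspace_eq_top
  have hmaps (μ : ℂ) : Set.MapsTo g (f.eigenspace μ) (f.eigenspace μ) := fun v hv => by
    rw [SetLike.mem_coe, hg μ v hv]
    exact Submodule.smul_mem _ _ hv
  rw [LinearMap.trace_eq_sum_trace_restrict' hint hfin hmaps]
  refine Finset.sum_congr rfl fun μ _ => ?_
  have hres : g.restrict (hmaps μ) = c μ • LinearMap.id := by
    ext v
    exact hg μ v v.2
  rw [hres, map_smul, LinearMap.trace_id, smul_eq_mul]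

open Module in
/-- If `f` has finite order, then the trace of its inverse is the conjugate of its trace. -/
theorem trace_eq_conj_trace_of_pow_eq_one {V : Type*} [AddCommGroup V] [Module ℂ V]
    [FiniteDimensional ℂ V] {f g : End ℂ V} {n : ℕ} (hn : n ≠ 0) (hf : f ^ n = 1)
    (hgf : g * f = 1) : LinearMap.trace ℂ V g = starRingEnd ℂ (LinearMap.trace ℂ V f) := by
  have hss : f.IsSemisimple := by
    refine End.isSemisimple_of_squarefree_aeval_eq_zero (p := Polynomial.X ^ n - 1) ?_
      (by simp [hf])
    have := Polynomial.separable_X_pow_sub_C (F := ℂ) (n := n) 1 (by exact_mod_cast hn) one_ne_zero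
    simpa using this.squarefree
  have hfin : {μ | f.eigenspace μ ≠ ⊥}.Finite := f.finite_hasEigenvalue
  rw [trace_eq_sum_of_eigenspaces hss g (fun μ => μ⁻¹) ?_ hfin,
    trace_eq_sum_of_eigenspaces hss f (fun μ => μ) (fun μ v hv => End.mem_eigenspace_iff.1 hv) hfin,
    map_sum]
  · refine Finset.sum_congr rfl fun μ hμ => ?_
    obtain ⟨v, hv, hv0⟩ := (Submodule.ne_bot_iff _).1 (hfin.mem_toFinset.1 hμ)
    have hpow : μ ^ n = 1 := by
      have h : (f ^ n) v = μ ^ n • v := End.HasEigenvector.pow_apply ⟨hv, hv0⟩ n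
      rw [hf, End.one_apply] at h
      refine smul_left_injective ℂ hv0 ?_
      simpa using h.symm
    simp [Complex.inv_eq_conj (Complex.norm_eq_one_of_pow_eq_one hpow hn)]
  · intro μ v hv
    have hv' := End.mem_eigenspace_iff.1 hv
    have h : g (f v) = v := by rw [← End.mul_apply, hgf, End.one_apply]
    rw [hv', map_smul] at h
    rcases eq_or_ne μ 0 with rfl | hμ
    · rw [zero_smul] at h
      simp [← h]
    · rw [eq_inv_smul_iff₀ hμ, h]

namespace Representation

variable {G : Type*} [Group G]

theorem character_inv_eq_conj [Finite G] {V : Type*} [AddCommGroup V] [Module ℂ V]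
    [FiniteDimensional ℂ V] (ρ : Representation ℂ G V) (g : G) :
    ρ.character g⁻¹ = starRingEnd ℂ (ρ.character g) := by
  refine trace_eq_conj_trace_of_pow_eq_one (n := orderOf g) (orderOf_pos g).ne' ?_ ?_
  · rw [← map_pow, pow_orderOf_eq_one, map_one]
  · rw [← map_mul, inv_mul_cancel, map_one]

/-- The character of a representation is the sum of the characters of two complementary
subrepresentations. -/
theorem character_eq_add_of_isCompl {V : Type*} [AddCommGroup V] [Module ℂ V]
    [FiniteDimensional ℂ V] (ρ : Representation ℂ G V) {σ τ : Subrepresentation ρ}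
    (h : IsCompl σ τ) (g : G) :
    ρ.character g = σ.toRepresentation.character g + τ.toRepresentation.character g := by
  have hc : IsCompl σ.toSubmodule τ.toSubmodule := by
    refine IsCompl.of_eq ?_ ?_
    · rw [← Subrepresentation.toSubmodule_inf, h.inf_eq_bot]; rfl
    · rw [← Subrepresentation.toSubmodule_sup, h.sup_eq_top]; rfl
  let N : Bool → Submodule ℂ V := fun b => cond b σ.toSubmodule τ.toSubmodule
  have hN : DirectSum.IsInternal N :=
    (DirectSum.isInternal_submodule_iff_isCompl N (i := true) (j := false) (by simp)
      (by ext b; cases b <;> simp)).2 hc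
  have hmaps : ∀ b, Set.MapsTo (ρ g) (N b) (N b) := by
    rintro (_ | _)
    · exact τ.apply_mem_toSubmodule g
    · exact σ.apply_mem_toSubmodule g
  rw [character, LinearMap.trace_eq_sum_trace_restrict hN hmaps, Fintype.sum_bool]
  rfl

/-- A representation whose character separates `x` and `y` contains an irreducible one whose
character separates `x` and `y`. -/
theorem exists_irreducible_character_ne [Finite G] (x y : G) {V : Type} [AddCommGroup V]
    [Module ℂ V] [FiniteDimensional ℂ V] (ρ : Representation ℂ G V)
    (h : ρ.character x ≠ ρ.character y) :
    ∃ (W : Type) (_ : AddCommGroup W) (_ : Module ℂ W) (_ : FiniteDimensional ℂ W)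
      (σ : Representation ℂ G W) (f : IntertwiningMap σ ρ),
      σ.IsIrreducible ∧ Function.Injective f ∧ σ.character x ≠ σ.character y := by
  induction hd : Module.finrank ℂ V using Nat.strong_induction_on generalizing V with
  | _ d ih =>
  by_cases hirr : ρ.IsIrreducible
  · exact ⟨V, _, _, inferInstance, ρ, IntertwiningMap.id ρ, hirr, Function.injective_id, h⟩
  have hnt : Nontrivial V := by
    by_contra hV
    rw [not_nontrivial_iff_subsingleton] at hV
    exact h (by simp [character, Subsingleton.elim (ρ x) (ρ y)])
  obtain ⟨σ, hbot, htop⟩ : ∃ σ : Subrepresentation ρ, σ ≠ ⊥ ∧ σ ≠ ⊤ := by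
    by_contra! hσ
    have : Nontrivial (Subrepresentation ρ) :=
      ⟨⊥, ⊤, fun he => bot_ne_top (congrArg Subrepresentation.toSubmodule he)⟩
    exact hirr (IsSimpleOrder.of_forall_eq_top hσ)
  obtain ⟨τ, hτ⟩ := exists_isCompl σ
  have htop' : τ ≠ ⊤ := fun he => hbot (eq_bot_of_isCompl_top (he ▸ hτ))
  obtain ⟨α, hα, hne⟩ : ∃ α : Subrepresentation ρ, α ≠ ⊤ ∧
      α.toRepresentation.character x ≠ α.toRepresentation.character y := by
    by_contra! hall
    exact h (by rw [character_eq_add_of_isCompl ρ hτ, character_eq_add_of_isCompl ρ hτ,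
      hall σ htop, hall τ htop'])
  have hlt : Module.finrank ℂ α.toSubmodule < d := hd ▸ Submodule.finrank_lt fun he =>
    hα (Subrepresentation.toSubmodule_injective he)
  obtain ⟨W, _, _, _, σ', f, hf, hinj, hne'⟩ := ih _ hlt α.toRepresentation hne rfl
  let i : IntertwiningMap α.toRepresentation ρ := ⟨α.toSubmodule.subtype, fun _ => rfl⟩
  exact ⟨W, _, _, inferInstance, σ', i.comp f, hf, Subtype.val_injective.comp hinj, hne'⟩

end Representation

theorem isIrrChar_character {G : Type} [Group G] [Finite G] {W : Type} [AddCommGroup W]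
    [Module ℂ W] [FiniteDimensional ℂ W] (σ : Representation ℂ G W) [σ.IsIrreducible] :
    IsIrrChar G σ.character := by
  have := Fintype.ofFinite G
  have hG : (Nat.card G : ℂ) ≠ 0 := by simp
  have := invertibleOfNonzero hG
  refine ⟨FDRep.of σ, (FDRep.simple_iff_char_is_norm_one _).2 ?_, fun g => rfl⟩
  have h := Representation.char_orthonormal σ σ
  rw [if_pos ⟨Representation.Equiv.refl σ⟩, inv_mul_eq_one₀ hG] at h
  exact h.symm

theorem charInner_character_ne_zero {G : Type} [Group G] [Fintype G] {V W : Type}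
    [AddCommGroup V] [Module ℂ V] [FiniteDimensional ℂ V] [AddCommGroup W] [Module ℂ W]
    [FiniteDimensional ℂ W] {ρ : Representation ℂ G V} {σ : Representation ℂ G W}
    {f : σ.IntertwiningMap ρ} (hf : f ≠ 0) : charInner G ρ.character σ.character ≠ 0 := by
  have := invertibleOfNonzero (show (Nat.card G : ℂ) ≠ 0 by simp)
  have : FiniteDimensional ℂ (σ.IntertwiningMap ρ) :=
    Module.Finite.equiv (Representation.invariantsEquivIntertwiningMap σ ρ)
  have : Nontrivial (σ.IntertwiningMap ρ) := ⟨f, 0, hf⟩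
  simp_rw [charInner, ← Representation.character_inv_eq_conj, ← Nat.card_eq_fintype_card]
  rw [Representation.card_inv_mul_sum_char_mul_char_eq_finrank, Nat.cast_ne_zero]
  exact Module.finrank_pos.ne'

/-- If `x^G, y^G` is a critical pair for a conjugation-closed set `I` of irreducible
characters, and `ψ` is a character with `ψ(x) = ψ(y) ≠ 0`, then for any `χ ∈ I` the
product `ψ·χ` has a constituent lying in `I`. -/
theorem saxl_stmt0 (G : Type) [Group G] [Fintype G] (x y : G) (I : Set (G → ℂ))
    (hIirr : ∀ χ ∈ I, IsIrrChar G χ)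
    (hIconj : ∀ χ ∈ I, (fun g => (starRingEnd ℂ) (χ g)) ∈ I)
    (hcrit₁ : ∀ χ ∈ I, χ x ≠ χ y)
    (hcrit₂ : ∀ χ : G → ℂ, IsIrrChar G χ → χ ∉ I → χ x = χ y)
    (ψ : G → ℂ) (hψ : IsChar G ψ) (hxy : ψ x = ψ y) (hx0 : ψ x ≠ 0)
    (χ : G → ℂ) (hχ : χ ∈ I) :
    ∃ ν ∈ I, charInner G (fun g => ψ g * χ g) ν ≠ 0 := by
  obtain ⟨V, hV⟩ := hψ
  obtain ⟨U, -, hU⟩ := hIirr χ hχ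
  have hprod : (fun g => ψ g * χ g) = (Representation.tprod V.ρ U.ρ).character := by
    rw [Representation.char_tensor]
    funext g
    rw [hV, hU]
    rfl
  have hne : (Representation.tprod V.ρ U.ρ).character x ≠
      (Representation.tprod V.ρ U.ρ).character y := by
    simp only [← hprod, ← hxy]
    exact fun h => hcrit₁ χ hχ (mul_left_cancel₀ hx0 h)
  obtain ⟨W, _, _, _, σ, f, hσ, hf, hσne⟩ :=
    Representation.exists_irreducible_character_ne x y _ hne
  refine ⟨σ.character, ?_, ?_⟩
  · by_contra hI
    exact hσne (hcrit₂ _ (isIrrChar_character σ) hI)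
  · rw [hprod]
    refine charInner_character_ne_zero (f := f) ?_
    rintro rfl
    have : Subsingleton W := ⟨fun a b => hf rfl⟩
    exact hσne (by simp [Representation.character, Subsingleton.elim (σ x) (σ y)])

end
end

section
/- If there exists a pair of conjugacy classes x^G, y^G of a finite group G that is a detecting pair for irreducible characters χ₁, χ₂ (i.e., χ₁ and χ₂ are the only irreducible characters with different values on x and y, and χ₁(x) - χ₁(y) = χ₂(y) - χ₂(x)), then either χ₂ is the complex conjugate of χ₁, or both χ₁ and χ₂ are real-valued. -/
open CategoryTheory

noncomputable section

/-- The representation obtained from `V` by complex conjugating its matrices in a basis. -/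
def FDRep.conjRep {G : Type} [Group G] (V : FDRep ℂ G) : FDRep ℂ G :=
  FDRep.of (V := Fin (Module.finrank ℂ V) → ℂ)
    { toFun g := Matrix.toLin' ((starRingEnd ℂ).mapMatrix
        (LinearMap.toMatrix (Module.finBasis ℂ V) (Module.finBasis ℂ V) (V.ρ g)))
      map_one' := by simp [Module.End.one_eq_id]
      map_mul' g h := by
        rw [map_mul V.ρ, LinearMap.toMatrix_mul, map_mul, Matrix.toLin'_mul, Module.End.mul_eq_comp] }

theorem FDRep.character_conjRep {G : Type} [Group G] (V : FDRep ℂ G) (g : G) :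
    V.conjRep.character g = (starRingEnd ℂ) (V.character g) := by
  have h : V.conjRep.character g = LinearMap.trace ℂ _ (Matrix.toLin' ((starRingEnd ℂ).mapMatrix
      (LinearMap.toMatrix (Module.finBasis ℂ V) (Module.finBasis ℂ V) (V.ρ g)))) := rfl
  rw [h, Matrix.trace_toLin'_eq, FDRep.character,
    LinearMap.trace_eq_matrix_trace ℂ (Module.finBasis ℂ V)]
  exact (AddMonoidHom.map_trace (starRingEnd ℂ) _).symm

theorem FDRep.simple_conjRep {G : Type} [Group G] [Fintype G] (V : FDRep ℂ G) [hV : Simple V] :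
    Simple V.conjRep := by
  rw [FDRep.simple_iff_char_is_norm_one] at hV ⊢
  simpa [FDRep.character_conjRep] using congrArg (starRingEnd ℂ) hV

theorem IsIrrChar.conj {G : Type} [Group G] [Fintype G] {χ : G → ℂ} (h : IsIrrChar G χ) :
    IsIrrChar G (fun g => (starRingEnd ℂ) (χ g)) := by
  obtain ⟨V, hV, hχ⟩ := h
  exact ⟨V.conjRep, V.simple_conjRep, fun g => by simp only [hχ, V.character_conjRep]⟩

/-- If `x^G, y^G` is a detecting pair for irreducible characters `χ₁, χ₂`, then either
`χ₂` is the complex conjugate of `χ₁`, or both characters are real-valued. -/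
theorem saxl_stmt3 (G : Type) [Group G] [Fintype G] (x y : G) (χ₁ χ₂ : G → ℂ)
    (h1 : IsIrrChar G χ₁) (h2 : IsIrrChar G χ₂)
    (hdet : χ₁ x - χ₁ y = χ₂ y - χ₂ x) (hne : χ₁ x ≠ χ₁ y) (hne₂ : χ₂ x ≠ χ₂ y)
    (hothers : ∀ χ : G → ℂ, IsIrrChar G χ → χ ≠ χ₁ → χ ≠ χ₂ → χ x = χ y) :
    (∀ g, χ₂ g = (starRingEnd ℂ) (χ₁ g)) ∨
      ((∀ g, (starRingEnd ℂ) (χ₁ g) = χ₁ g) ∧ (∀ g, (starRingEnd ℂ) (χ₂ g) = χ₂ g)) := by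
  have conj_eq {χ : G → ℂ} (h : IsIrrChar G χ) (hχ : χ x ≠ χ y) :
      (fun g => (starRingEnd ℂ) (χ g)) = χ₁ ∨ (fun g => (starRingEnd ℂ) (χ g)) = χ₂ := by
    by_contra! hc
    exact hχ ((starRingEnd ℂ).injective (hothers _ h.conj hc.1 hc.2))
  rcases conj_eq h1 hne with h | h
  · rcases conj_eq h2 hne₂ with h' | h'
    · left
      intro g
      rw [← h', Complex.conj_conj]
    · exact .inr ⟨congrFun h, congrFun h'⟩
  · exact .inl fun g => (congrFun h g).symm

end
end
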